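/- arXiv:math/0702028 — 4 statements merged into one kernel-verified Lean document; each statement's English description precedes it below -/
import Mathlib

section
/- Let 0 → M₁ → M → M₂ → 0 be a short exact sequence of R-modules. Then M is a uniformly finite R-module if and only if both M₁ and M₂ are uniformly finite R-modules. -/
/-!
Definitions following Bavula, "Primary decompositions for left Noetherian rings".
All modules are left modules over an associative ring `R` with 1.
-/

universe u v

section Defs

variable (R : Type u) [Ring R]

/-- `N` is an essential submodule of the module `A`:
it intersects every nonzero submodule of `A` nontrivially. -/
def EssentialSub {A : Type v} [AddCommGroup A] [Module R A] (N : Submodule R A) : Prop :=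
  ∀ L : Submodule R A, L ≠ ⊥ → N ⊓ L ≠ ⊥

/-- A module `A` is uniform: it is nonzero and every nonzero submodule is essential. -/
def UniformMod (A : Type v) [AddCommGroup A] [Module R A] : Prop :=
  Nontrivial A ∧ ∀ V : Submodule R A, V ≠ ⊥ → EssentialSub R V

/-- A submodule is uniform if it is uniform as a module. -/
def UniformSub {A : Type v} [AddCommGroup A] [Module R A] (U : Submodule R A) : Prop :=
  UniformMod R ↥U

/-- `A` has finite uniform dimension:
it contains no infinite direct sum of nonzero submodules. -/
def FinUdim (A : Type v) [AddCommGroup A] [Module R A] : Prop :=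
  ¬ ∃ f : ℕ → Submodule R A, (∀ n, f n ≠ ⊥) ∧ iSupIndep f

/-- `A` has uniform dimension `n`: there is an essential direct sum of `n`
uniform submodules of `A`. -/
def UdimEq (A : Type v) [AddCommGroup A] [Module R A] (n : ℕ) : Prop :=
  ∃ U : Fin n → Submodule R A, (∀ i, UniformSub R (U i)) ∧
    iSupIndep U ∧ EssentialSub R (⨆ i, U i)

/-- Essential equivalence of modules: they possess isomorphic essential submodules. -/
def EssEquiv (A B : ModuleCat.{v} R) : Prop :=
  ∃ (L₁ : Submodule R A) (L₂ : Submodule R B),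
    EssentialSub R L₁ ∧ EssentialSub R L₂ ∧ Nonempty (L₁ ≃ₗ[R] L₂)

/-- The left spectrum-style quotient: classes `[A]` of modules under essential
equivalence (for uniform modules these classes are the left primes). -/
def LeftSpec := Quot (EssEquiv R)

/-- The class `[A]` of the module `A` under essential equivalence. -/
def leftPrime (A : Type v) [AddCommGroup A] [Module R A] : LeftSpec.{u, v} R :=
  Quot.mk _ (ModuleCat.of R A)

/-- The set `As_R(A)` of associated left primes of `A`:
the classes of the uniform submodules of `A`. -/
def leftAss (A : Type v) [AddCommGroup A] [Module R A] : Set (LeftSpec.{u, v} R) :=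
  { x | ∃ U : Submodule R A, UniformSub R U ∧ x = leftPrime R ↥U }

/-- `A` is uniformly finite: every factor module of `A` has finite uniform dimension. -/
def UniformlyFinite (A : Type v) [AddCommGroup A] [Module R A] : Prop :=
  ∀ N : Submodule R A, FinUdim R (A ⧸ N)

/-- `N` is an `X`-primary submodule of `A`: `A/N` has finite uniform dimension and
`As_R(A/N) = {X}`. -/
def PrimarySub {A : Type v} [AddCommGroup A] [Module R A] (N : Submodule R A)
    (X : LeftSpec.{u, v} R) : Prop :=
  FinUdim R (A ⧸ N) ∧ leftAss R (A ⧸ N) = {X}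

/-- `Ns` is a primary decomposition of `N` in `A`. -/
def IsPrimaryDecomp {A : Type v} [AddCommGroup A] [Module R A] (N : Submodule R A)
    (s : ℕ) (Ns : Fin s → Submodule R A) : Prop :=
  N = ⨅ i, Ns i ∧ ∀ i, ∃ X, PrimarySub R (Ns i) X

/-- `Ns` is a shortest primary decomposition of `N` in `A`:
no primary decomposition of `N` in `A` has fewer terms. -/
def IsShortestPrimaryDecomp {A : Type v} [AddCommGroup A] [Module R A] (N : Submodule R A)
    (s : ℕ) (Ns : Fin s → Submodule R A) : Prop :=
  IsPrimaryDecomp R N s Ns ∧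
    ∀ (t : ℕ) (Ls : Fin t → Submodule R A), IsPrimaryDecomp R N t Ls → s ≤ t

/-- `C` is a complement to `W` in the ambient module: `W ⊓ C = ⊥` and `C` is maximal
with this property. -/
def IsComplementTo {A : Type v} [AddCommGroup A] [Module R A] (C W : Submodule R A) : Prop :=
  W ⊓ C = ⊥ ∧ ∀ D : Submodule R A, C ≤ D → W ⊓ D = ⊥ → D = C

/-- A proper submodule `N ⊊ A` is irreducible if it is not the intersection of two
strictly larger submodules. -/
def IrreducibleSub {A : Type v} [AddCommGroup A] [Module R A] (N : Submodule R A) : Prop :=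
  N ≠ ⊤ ∧ ¬ ∃ P Q : Submodule R A, N < P ∧ N < Q ∧ N = P ⊓ Q

/-- The multiplicity of the left prime `x` in `A` is `m`: in some (equivalently, any)
essential direct sum of uniform submodules of `A`, exactly `m` summands lie in class `x`. -/
def HasMult (A : Type v) [AddCommGroup A] [Module R A] (x : LeftSpec.{u, v} R) (m : ℕ) : Prop :=
  ∃ (n : ℕ) (U : Fin n → Submodule R A), (∀ i, UniformSub R (U i)) ∧
    iSupIndep U ∧ EssentialSub R (⨆ i, U i) ∧
    m = Nat.card {i : Fin n // leftPrime R ↥(U i) = x}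

end Defs

section FinUdim

variable {R : Type*} [Ring R] {A B C ι : Type*} [AddCommGroup A] [Module R A]
  [AddCommGroup B] [Module R B] [AddCommGroup C] [Module R C]

theorem iSupIndep.map_of_disjoint_ker {F : ι → Submodule R A} (hF : iSupIndep F)
    (φ : A →ₗ[R] B) (hφ : Disjoint (LinearMap.ker φ) (⨆ i, F i)) :
    iSupIndep fun i => (F i).map φ := by
  intro i
  simp only [← Submodule.map_iSup]
  rw [Submodule.disjoint_def]
  rintro _ ⟨a, ha, rfl⟩ ⟨b, hb, hab⟩
  have hb' : b ∈ ⨆ i, F i := iSup₂_le_iSup (fun j => j ≠ i) F hb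
  have h : a - b = 0 := Submodule.disjoint_def.1 hφ _ (by simp [hab])
    (sub_mem (le_iSup F i ha) hb')
  rw [← sub_eq_zero.1 h] at hb
  rw [Submodule.disjoint_def.1 (hF i) a ha hb, map_zero]

theorem iSupIndep.comap_of_injective {F : ι → Submodule R B} (hF : iSupIndep F)
    {φ : A →ₗ[R] B} (hφ : Function.Injective φ) :
    iSupIndep fun i => (F i).comap φ := by
  intro i
  rw [Submodule.disjoint_def]
  intro x hx hx'
  refine hφ ?_
  rw [map_zero]
  refine Submodule.disjoint_def.1 (hF i) _ hx ?_
  have h : φ x ∈ (⨆ j, ⨆ _ : j ≠ i, (F j).comap φ).map φ := Submodule.mem_map_of_mem hx'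
  simp only [Submodule.map_iSup] at h
  exact iSup₂_mono (fun j _ => Submodule.map_comap_le φ (F j)) h

theorem iSupIndep.iSup_prod {κ : Type*} {F : ι × κ → Submodule R A} (hF : iSupIndep F) :
    iSupIndep fun i => ⨆ k, F (i, k) := by
  intro i
  refine (hF.disjoint_biSup_biSup (s := {p | p.1 = i}) (t := {p | p.1 ≠ i}) ?_).mono ?_ ?_
  · exact Set.disjoint_left.2 fun p hp hp' => hp' hp
  · exact iSup_le fun k => le_biSup F (show (i, k) ∈ {p : ι × κ | p.1 = i} from rfl)
  · exact iSup₂_le fun j hj => iSup_le fun k =>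
      le_biSup F (show (j, k) ∈ {p : ι × κ | p.1 ≠ i} from hj)

theorem FinUdim.of_injective (hB : FinUdim R B) {φ : A →ₗ[R] B} (hφ : Function.Injective φ) :
    FinUdim R A := by
  rintro ⟨F, hne, hF⟩
  refine hB ⟨fun n => (F n).map φ, fun n h => hne n ?_, hF.map_of_disjoint_ker φ ?_⟩
  · exact Submodule.map_injective_of_injective hφ (by simpa using h)
  · simp [LinearMap.ker_eq_bot.2 hφ]

theorem FinUdim.of_ker_le_range (hA : FinUdim R A) (hC : FinUdim R C) {i : A →ₗ[R] B}
    {p : B →ₗ[R] C} (hi : Function.Injective i) (hip : LinearMap.ker p ≤ LinearMap.range i) :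
    FinUdim R B := by
  rintro ⟨F, hne, hF⟩
  have hG : iSupIndep (F ∘ Nat.pairEquiv) := hF.comp Nat.pairEquiv.injective
  obtain ⟨n, hn⟩ : ∃ n, Disjoint (LinearMap.ker p) (⨆ k, F (Nat.pair n k)) := by
    by_contra! h
    refine hA ⟨_, fun n hn => h n ?_, hG.iSup_prod.comap_of_injective hi⟩
    rw [Submodule.disjoint_def]
    intro x hx hx'
    obtain ⟨a, rfl⟩ := hip hx
    rw [(Submodule.eq_bot_iff _).1 hn a hx', map_zero]
  refine hC ⟨_, fun k hk => hne (Nat.pair n k) ?_,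
    (hG.comp (Prod.mk_right_injective n)).map_of_disjoint_ker p hn⟩
  have hle : F (Nat.pair n k) ≤ LinearMap.ker p := LinearMap.le_ker_iff_map.2 hk
  exact disjoint_self.1 (hn.mono hle (le_iSup (fun k => F (Nat.pair n k)) k))

end FinUdim

/-- Lemma `ufm13`(1): for a short exact sequence
`0 → M₁ → M → M₂ → 0`, the module `M` is uniformly finite iff both `M₁` and `M₂`
are uniformly finite. -/
theorem uniformlyFinite_iff_of_shortExact
    {R : Type u} [Ring R] {M₁ M M₂ : Type v}
    [AddCommGroup M₁] [Module R M₁] [AddCommGroup M] [Module R M]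
    [AddCommGroup M₂] [Module R M₂]
    (f : M₁ →ₗ[R] M) (g : M →ₗ[R] M₂)
    (hf : Function.Injective f) (hg : Function.Surjective g)
    (hfg : LinearMap.range f = LinearMap.ker g) :
    UniformlyFinite R M ↔ UniformlyFinite R M₁ ∧ UniformlyFinite R M₂ := by
  have comap_mapQ_injective (N : Submodule R M) :
      Function.Injective ((N.comap f).mapQ N f le_rfl) := by
    rw [← LinearMap.ker_eq_bot, Submodule.ker_mapQ, Submodule.mkQ_map_self]
  refine ⟨fun h => ⟨fun N => ?_, fun N => ?_⟩, fun ⟨h₁, h₂⟩ N => ?_⟩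
  · have h₁ := (h (N.map f)).of_injective (comap_mapQ_injective (N.map f))
    rwa [Submodule.comap_map_eq_of_injective hf] at h₁
  · have e := (N.mkQ ∘ₗ g).quotKerEquivOfSurjective (N.mkQ_surjective.comp hg)
    exact (h _).of_injective e.symm.injective
  · refine (h₁ _).of_ker_le_range (h₂ (N.map g)) (comap_mapQ_injective N)
      (p := N.mapQ (N.map g) g (Submodule.le_comap_map g N)) ?_
    rw [Submodule.ker_mapQ, Submodule.range_mapQ, Submodule.comap_map_eq, hfg,
      Submodule.map_sup, Submodule.mkQ_map_self, bot_sup_eq]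
end

section
/- Let X be a left prime and let N₁, ..., N_s be X-primary submodules of an R-module M. Then the intersection N₁ ∩ ⋯ ∩ N_s is an X-primary submodule of M. -/
/-!
Definitions following Bavula, "Primary decompositions for left Noetherian rings".
All modules are left modules over an associative ring `R` with 1.
-/

universe u v

section Helpers

variable {R : Type u} [Ring R] {A B C : Type v} [AddCommGroup A] [Module R A]
  [AddCommGroup B] [Module R B] [AddCommGroup C] [Module R C]

/-- A linear map preserves independence of a family of submodules whose sum meets its kernel
trivially. -/
lemma iSupIndep_map_of_disjoint_ker {ι : Type*} {f : ι → Submodule R A} (hf : iSupIndep f)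
    (p : A →ₗ[R] B) (hp : Disjoint (⨆ i, f i) (LinearMap.ker p)) :
    iSupIndep fun i => (f i).map p := by
  intro i
  simp_rw [← Submodule.map_iSup]
  rw [Submodule.disjoint_def]
  rintro _ ⟨x, hx, rfl⟩ ⟨y, hy, hxy⟩
  have hyW : y ∈ ⨆ i, f i := (iSup₂_le fun j _ => le_iSup f j) hy
  have hxW : x ∈ ⨆ i, f i := le_iSup f i hx
  have h0 : x - y = 0 := Submodule.disjoint_def.mp hp _ (sub_mem hxW hyW) (by simp [hxy])
  have hx0 : x = 0 :=
    Submodule.disjoint_def.mp (hf i) x hx (by rwa [sub_eq_zero.mp h0])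
  simp [hx0]

lemma not_finUdim_of_disjoint_ker {f : ℕ → Submodule R A} (hf : iSupIndep f)
    (hne : ∀ n, f n ≠ ⊥) (p : A →ₗ[R] B) (hp : Disjoint (⨆ i, f i) (LinearMap.ker p)) :
    ¬ FinUdim R B := by
  refine not_not_intro ⟨fun i => (f i).map p, fun n hn => hne n ?_,
    iSupIndep_map_of_disjoint_ker hf p hp⟩
  exact (hp.mono_left (le_iSup f n)).eq_bot_of_le (LinearMap.le_ker_iff_map.mpr hn)

lemma iSupIndep_iSup_pair {f : ℕ → Submodule R A} (hf : iSupIndep f) :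
    iSupIndep fun k => ⨆ j, f (Nat.pair k j) := by
  intro k
  have key := hf.disjoint_biSup_biSup (s := {n | n.unpair.1 = k}) (t := {n | n.unpair.1 = k}ᶜ)
    disjoint_compl_right
  refine key.mono (iSup_le fun j => ?_) (iSup₂_le fun l hl => iSup_le fun j => ?_)
  · exact le_iSup₂_of_le (Nat.pair k j) (by simp) le_rfl
  · exact le_iSup₂_of_le (Nat.pair l j) (by simpa using hl) le_rfl

/-- A module which embeds jointly in two modules of finite uniform dimension has finite uniform
dimension. -/
lemma FinUdim.of_disjoint_ker (hB : FinUdim R B) (hC : FinUdim R C) (p : A →ₗ[R] B)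
    (q : A →ₗ[R] C) (hpq : Disjoint (LinearMap.ker p) (LinearMap.ker q)) : FinUdim R A := by
  rintro ⟨f, hne, hf⟩
  by_cases h : ∀ k, (⨆ j, f (Nat.pair k j)) ⊓ LinearMap.ker p ≠ ⊥
  · exact not_finUdim_of_disjoint_ker ((iSupIndep_iSup_pair hf).mono fun _ => inf_le_left) h q
      (hpq.mono_left (iSup_le fun _ => inf_le_right)) hC
  · push Not at h
    obtain ⟨k, hk⟩ := h
    exact not_finUdim_of_disjoint_ker
      (hf.comp (f := Nat.pair k) fun a b hab => (Nat.pair_eq_pair.mp hab).2)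
      (fun _ => hne _) p (disjoint_iff.mpr hk) hB

lemma uniformSub_iff {U : Submodule R A} : UniformSub R U ↔ U ≠ ⊥ ∧
    ∀ P Q : Submodule R A, P ≤ U → Q ≤ U → P ≠ ⊥ → Q ≠ ⊥ → ¬ Disjoint P Q := by
  have hmap (V : Submodule R U) : V.map U.subtype = ⊥ ↔ V = ⊥ :=
    by
    rw [← LinearMap.le_ker_iff_map, Submodule.ker_subtype, le_bot_iff]
  refine and_congr (Submodule.nontrivial_iff_ne_bot) ⟨fun h P Q hP hQ hP0 hQ0 hd => ?_,
    fun h P hP Q hQ hPQ => ?_⟩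
  · refine h (P.submoduleOf U) ?_ (Q.submoduleOf U) ?_ ?_
    · rwa [Ne, Submodule.submoduleOf, ← Submodule.disjoint_iff_comap_eq_bot, disjoint_iff,
        inf_eq_right.mpr hP]
    · rwa [Ne, Submodule.submoduleOf, ← Submodule.disjoint_iff_comap_eq_bot, disjoint_iff,
        inf_eq_right.mpr hQ]
    · rw [Submodule.submoduleOf, Submodule.submoduleOf, ← Submodule.comap_inf, hd.eq_bot]
      simp
  · refine h (P.map U.subtype) (Q.map U.subtype) (Submodule.map_subtype_le _ _)
      (Submodule.map_subtype_le _ _) (by rwa [Ne, hmap]) (by rwa [Ne, hmap]) ?_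
    rw [disjoint_iff, ← Submodule.map_inf _ U.injective_subtype, hPQ, Submodule.map_bot]

/-- If each term of an antitone sequence `V` contains `f n` and meets it trivially one step later,
then `f` is independent. -/
lemma iSupIndep_of_antitone {V f : ℕ → Submodule R A} (hV : Antitone V) (hle : ∀ n, f n ≤ V n)
    (hd : ∀ n, Disjoint (f n) (V (n + 1))) : iSupIndep f := by
  classical
  rw [iSupIndep_iff_finsetSum_eq_zero_imp_eq_zero]
  intro s v hv hs i
  induction i using Nat.strong_induction_on with
  | _ i ih =>
    intro hi
    refine Submodule.disjoint_def.mp (hd i) _ (hv i hi) ?_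
    rw [← Finset.add_sum_erase s v hi] at hs
    rw [eq_neg_of_add_eq_zero_left hs]
    refine neg_mem (sum_mem fun j hj => ?_)
    obtain ⟨hji, hjs⟩ := Finset.mem_erase.mp hj
    rcases lt_or_gt_of_ne hji with hlt | hgt
    · rw [ih j hlt hjs]
      exact zero_mem _
    · exact hV hgt (hle j (hv j hjs))

/-- A nonzero module of finite uniform dimension contains a uniform submodule. -/
lemma FinUdim.exists_uniformSub [Nontrivial A] (hA : FinUdim R A) :
    ∃ U : Submodule R A, UniformSub R U := by
  by_contra! hU
  have step (V : {V : Submodule R A // V ≠ ⊥}) : ∃ (P : Submodule R A)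
      (Q : {V : Submodule R A // V ≠ ⊥}), P ≠ ⊥ ∧ P ≤ V ∧ Q.1 ≤ V ∧ Disjoint P Q := by
    have h := hU V
    rw [uniformSub_iff] at h
    push Not at h
    obtain ⟨P, Q, hP, hQ, hP0, hQ0, hd⟩ := h V.2
    exact ⟨P, ⟨Q, hQ0⟩, hP0, hP, hQ, hd⟩
  choose P Q hP0 hP hQ hd using step
  let V : ℕ → {V : Submodule R A // V ≠ ⊥} := fun n => Q^[n] ⟨⊤, top_ne_bot⟩
  have hV (n : ℕ) : V (n + 1) = Q (V n) := Function.iterate_succ_apply' _ _ _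
  refine hA ⟨fun n => P (V n), fun n => hP0 _,
    iSupIndep_of_antitone (V := fun n => (V n).1) (antitone_nat_of_succ_le fun n => ?_)
      (fun n => hP _) fun n => ?_⟩
  · rw [hV]
    exact hQ _
  · rw [hV]
    exact hd _

lemma UniformMod.of_linearEquiv (e : A ≃ₗ[R] B) (hA : UniformMod R A) : UniformMod R B := by
  have hbot (V : Submodule R B) : V.comap (e : A →ₗ[R] B) = ⊥ ↔ V = ⊥ :=
    map_eq_bot_iff (Submodule.orderIsoMapComap e).symm
  have := hA.1
  refine ⟨e.symm.toEquiv.nontrivial, fun V hV L hL hVL => ?_⟩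
  refine hA.2 (V.comap (e : A →ₗ[R] B)) (by rwa [Ne, hbot]) (L.comap (e : A →ₗ[R] B))
    (by rwa [Ne, hbot]) ?_
  rw [← Submodule.comap_inf, hbot, hVL]

lemma leftPrime_eq_of_linearEquiv (e : A ≃ₗ[R] B) : leftPrime R A = leftPrime R B :=
  Quot.sound ⟨⊤, ⊤, fun L hL => by rwa [top_inf_eq], fun L hL => by rwa [top_inf_eq],
    ⟨(Submodule.topEquiv.trans e).trans Submodule.topEquiv.symm⟩⟩

/-- The class of a uniform submodule meeting the kernel of `p : A → B` trivially is an associated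
left prime of `B`. -/
lemma leftPrime_mem_leftAss_of_disjoint_ker {U : Submodule R A} (hU : UniformSub R U)
    (p : A →ₗ[R] B) (hp : Disjoint U (LinearMap.ker p)) : leftPrime R U ∈ leftAss R B := by
  have hinj : Function.Injective (p.submoduleMap U) := by
    rw [← LinearMap.ker_eq_bot, LinearMap.ker_eq_bot']
    intro x hx
    exact Subtype.ext (Submodule.disjoint_def.mp hp x x.2 (congrArg Subtype.val hx))
  let e := LinearEquiv.ofBijective (p.submoduleMap U) ⟨hinj, p.submoduleMap_surjective U⟩
  exact ⟨U.map p, UniformMod.of_linearEquiv e hU, leftPrime_eq_of_linearEquiv e⟩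

lemma leftAss_subset_union_of_disjoint_ker (p : A →ₗ[R] B) (q : A →ₗ[R] C)
    (hpq : Disjoint (LinearMap.ker p) (LinearMap.ker q)) :
    leftAss R A ⊆ leftAss R B ∪ leftAss R C := by
  rintro _ ⟨U, hU, rfl⟩
  by_cases hp : Disjoint U (LinearMap.ker p)
  · exact Or.inl (leftPrime_mem_leftAss_of_disjoint_ker hU p hp)
  · refine Or.inr (leftPrime_mem_leftAss_of_disjoint_ker hU q ?_)
    by_contra hq
    rw [disjoint_iff] at hp hq
    exact (uniformSub_iff.mp hU).2 _ _ inf_le_left inf_le_left hp hq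
      (hpq.mono inf_le_right inf_le_right)

lemma PrimarySub.ne_top {N : Submodule R A} {X : LeftSpec.{u, v} R} (h : PrimarySub R N X) :
    N ≠ ⊤ := by
  obtain ⟨U, hU, -⟩ : X ∈ leftAss R (A ⧸ N) := h.2 ▸ rfl
  rintro rfl
  exact (uniformSub_iff.mp hU).1 (Subsingleton.elim _ _)

lemma PrimarySub.inf {N₁ N₂ : Submodule R A} {X : LeftSpec.{u, v} R} (h₁ : PrimarySub R N₁ X)
    (h₂ : PrimarySub R N₂ X) : PrimarySub R (N₁ ⊓ N₂) X := by
  have hpq : Disjoint (LinearMap.ker (Submodule.factor (inf_le_left : N₁ ⊓ N₂ ≤ N₁)))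
      (LinearMap.ker (Submodule.factor (inf_le_right : N₁ ⊓ N₂ ≤ N₂))) := by
    rw [Submodule.disjoint_def]
    intro x
    obtain ⟨x, rfl⟩ := Submodule.mkQ_surjective _ x
    simp +contextual
  have hfin := FinUdim.of_disjoint_ker h₁.1 h₂.1 _ _ hpq
  have hsub := leftAss_subset_union_of_disjoint_ker _ _ hpq
  rw [h₁.2, h₂.2, Set.union_self] at hsub
  have : Nontrivial (A ⧸ N₁ ⊓ N₂) :=
    Submodule.Quotient.nontrivial_iff.mpr fun h => h₁.ne_top (inf_eq_top_iff.mp h).1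
  obtain ⟨U, hU⟩ := hfin.exists_uniformSub
  have hne : (leftAss R (A ⧸ N₁ ⊓ N₂)).Nonempty := ⟨_, U, hU, rfl⟩
  exact ⟨hfin, hne.subset_singleton_iff.mp hsub⟩

end Helpers

/-- Lemma `intprim`: the intersection of `X`-primary submodules
`N₁, …, N_s` (with `s ≥ 1`) of a module `M` is again `X`-primary. -/
theorem primary_iInf
    {R : Type u} [Ring R] {M : Type v} [AddCommGroup M] [Module R M]
    (X : LeftSpec.{u, v} R) (s : ℕ) (hs : 0 < s)
    (Ns : Fin s → Submodule R M) (h : ∀ i, PrimarySub R (Ns i) X) :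
    PrimarySub R (⨅ i, Ns i) X := by
  have : Nonempty (Fin s) := ⟨⟨0, hs⟩⟩
  rw [← Finset.inf'_univ_eq_ciInf]
  exact Finset.inf'_induction (p := fun N => PrimarySub R N X) _ _ (fun _ h₁ _ h₂ => h₁.inf h₂) fun i _ => h i
end

section
/- Let M be a nonzero uniformly finite R-module, N a submodule with N ≠ M, and N = L₁ ∩ ⋯ ∩ L_r a primary decomposition of N in M. Then this decomposition is shortest if and only if r equals the number of elements of As_R(M/N). -/
/-!
Definitions following Bavula, "Primary decompositions for left Noetherian rings".
All modules are left modules over an associative ring `R` with 1.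
-/

universe u v

section Uniform

variable {R : Type u} [Ring R]

/-- A nonzero module embedding into a uniform module is uniform, of the same class. -/
theorem UniformMod.of_injective {A B : Type v} [AddCommGroup A] [Module R A] [AddCommGroup B]
    [Module R B] [Nontrivial A] (hB : UniformMod R B) (f : A →ₗ[R] B)
    (hf : Function.Injective f) : UniformMod R A ∧ leftPrime R A = leftPrime R B := by
  have map_ne_bot {V : Submodule R A} (hV : V ≠ ⊥) : V.map f ≠ ⊥ := fun h =>
    hV (Submodule.map_injective_of_injective hf (by rw [h, Submodule.map_bot]))
  refine ⟨⟨inferInstance, fun V hV L hL h => ?_⟩, Quot.sound ⟨⊤, LinearMap.range f, ?_, ?_, ?_⟩⟩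
  · apply hB.2 _ (map_ne_bot hV) _ (map_ne_bot hL)
    rw [← Submodule.map_inf f hf, h, Submodule.map_bot]
  · intro L hL
    rwa [top_inf_eq]
  · apply hB.2
    rw [LinearMap.range_eq_map]
    exact map_ne_bot top_ne_bot
  · exact ⟨Submodule.topEquiv.trans (LinearEquiv.ofInjective f hf)⟩

theorem leftPrime_mem_leftAss {A B : Type v} [AddCommGroup A] [Module R A] [AddCommGroup B]
    [Module R B] (hA : UniformMod R A) (f : A →ₗ[R] B) (hf : Function.Injective f) :
    leftPrime R A ∈ leftAss R B := by
  have := hA.1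
  let e := LinearEquiv.ofInjective f hf
  have := e.symm.toEquiv.nontrivial
  obtain ⟨h₁, h₂⟩ := hA.of_injective e.symm.toLinearMap e.symm.injective
  exact ⟨LinearMap.range f, h₁, h₂.symm⟩

theorem leftAss_subset_of_injective {A B : Type v} [AddCommGroup A] [Module R A] [AddCommGroup B]
    [Module R B] (f : A →ₗ[R] B) (hf : Function.Injective f) : leftAss R A ⊆ leftAss R B := by
  rintro _ ⟨U, hU, rfl⟩
  exact leftPrime_mem_leftAss hU (f ∘ₗ U.subtype) (hf.comp U.injective_subtype)

theorem leftAss_eq_empty_of_subsingleton {A : Type v} [AddCommGroup A] [Module R A]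
    [Subsingleton A] : leftAss R A = ∅ := by
  rw [Set.eq_empty_iff_forall_notMem]
  rintro _ ⟨U, hU, -⟩
  exact not_subsingleton_iff_nontrivial.mpr hU.1 inferInstance

theorem UniformMod.exists_eq_bot_of_iInf_eq_bot {A : Type v} [AddCommGroup A] [Module R A]
    (hA : UniformMod R A) {ι : Type*} [Finite ι] {K : ι → Submodule R A} (hK : ⨅ i, K i = ⊥) :
    ∃ i, K i = ⊥ := by
  classical
  have := Fintype.ofFinite ι
  have := hA.1
  by_contra! h
  have key (s : Finset ι) : s.inf K ≠ ⊥ := by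
    induction s using Finset.induction_on with
    | empty => simp
    | insert a s _ ih =>
      rw [Finset.inf_insert]
      exact hA.2 _ (h a) _ ih
  exact key Finset.univ (by rw [Finset.inf_univ_eq_iInf, hK])

/-- The associated left primes of a module are among those of the targets of any finite
jointly injective family of linear maps. -/
theorem leftAss_subset_iUnion {A : Type v} [AddCommGroup A] [Module R A] {ι : Type*} [Finite ι]
    {B : ι → Type v} [∀ i, AddCommGroup (B i)] [∀ i, Module R (B i)] (g : ∀ i, A →ₗ[R] B i)
    (hg : ⨅ i, LinearMap.ker (g i) = ⊥) : leftAss R A ⊆ ⋃ i, leftAss R (B i) := by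
  rintro _ ⟨U, hU, rfl⟩
  have h : ⨅ i, LinearMap.ker (g i ∘ₗ U.subtype) = ⊥ := by
    simp_rw [LinearMap.ker_comp]
    rw [← Submodule.comap_iInf, hg, Submodule.comap_bot, Submodule.ker_subtype]
  obtain ⟨i, hi⟩ := UniformMod.exists_eq_bot_of_iInf_eq_bot hU h
  exact Set.mem_iUnion.mpr ⟨i, leftPrime_mem_leftAss hU _ (LinearMap.ker_eq_bot.mp hi)⟩

theorem uniformSub_of_forall_inf_ne_bot {A : Type v} [AddCommGroup A] [Module R A]
    {U : Submodule R A} (hU : U ≠ ⊥)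
    (h : ∀ V ≤ U, ∀ W ≤ U, V ≠ ⊥ → W ≠ ⊥ → V ⊓ W ≠ ⊥) : UniformSub R U := by
  have hinj := U.injective_subtype
  have map_ne_bot {V : Submodule R U} (hV : V ≠ ⊥) : V.map U.subtype ≠ ⊥ := fun h =>
    hV (Submodule.map_injective_of_injective hinj (by rw [h, Submodule.map_bot]))
  refine ⟨Submodule.nontrivial_iff_ne_bot.mpr hU, fun V hV L hL hVL => ?_⟩
  refine h _ (Submodule.map_subtype_le _ _) _ (Submodule.map_subtype_le _ _)
    (map_ne_bot hV) (map_ne_bot hL) ?_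
  rw [← Submodule.map_inf _ hinj, hVL, Submodule.map_bot]

/-- Splitting off one summand after another from a descending chain yields an independent
sequence. -/
theorem iSupIndep_of_disjoint_of_le_antitone {A : Type v} [AddCommGroup A] [Module R A]
    {f V : ℕ → Submodule R A} (hV : Antitone V) (hle : ∀ n, f n ≤ V n)
    (hd : ∀ n, Disjoint (f n) (V (n + 1))) : iSupIndep f := by
  rw [iSupIndep_iff_finsetSum_eq_zero_imp_eq_zero]
  intro s x hx hs i
  induction i using Nat.strong_induction_on with
  | _ i ih =>
    intro hi
    have hx' (j) (hj : j ∈ s) : x j ∈ f j := hx j hj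
    have hsum : x i + ∑ j ∈ s.erase i, x j = 0 := by rw [Finset.add_sum_erase s x hi, hs]
    refine Submodule.disjoint_def.mp (hd i) _ (hx' i hi) ?_
    rw [eq_neg_of_add_eq_zero_left hsum]
    refine Submodule.neg_mem _ (Submodule.sum_mem _ fun j hj => ?_)
    obtain ⟨hji, hj⟩ := Finset.mem_erase.mp hj
    rcases lt_or_gt_of_ne hji with h | h
    · rw [ih j h hj]
      exact Submodule.zero_mem _
    · exact hV h (hle j (hx' j hj))

theorem FinUdim.exists_uniformSub_le {A : Type v} [AddCommGroup A] [Module R A]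
    (hA : FinUdim R A) {V : Submodule R A} (hV : V ≠ ⊥) : ∃ U ≤ V, UniformSub R U := by
  by_contra! hno
  have step (P : {P : Submodule R A // P ≤ V ∧ P ≠ ⊥}) :
      ∃ (Q : {P : Submodule R A // P ≤ V ∧ P ≠ ⊥}) (W : Submodule R A),
        Q.1 ≤ P.1 ∧ W ≤ P.1 ∧ W ≠ ⊥ ∧ Disjoint W Q.1 := by
    by_contra! h
    refine hno P.1 P.2.1 (uniformSub_of_forall_inf_ne_bot P.2.2 fun Q hQ W hW hQ' hW' hQW => ?_)
    exact h ⟨Q, hQ.trans P.2.1, hQ'⟩ W hQ hW hW' (disjoint_iff.mpr (by rw [inf_comm, hQW]))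
  choose Q W hQ hW hW' hd using step
  let C (n : ℕ) := Q^[n] ⟨V, le_rfl, hV⟩
  have hC (n : ℕ) : C (n + 1) = Q (C n) := Function.iterate_succ_apply' _ _ _
  refine hA ⟨fun n => W (C n), fun n => hW' _,
    iSupIndep_of_disjoint_of_le_antitone (V := fun n => (C n).1) ?_ (fun n => hW _) fun n => ?_⟩
  · refine antitone_nat_of_succ_le fun n => ?_
    rw [hC]
    exact hQ _
  · simp only [hC]
    exact hd _

theorem FinUdim.leftAss_nonempty {A : Type v} [AddCommGroup A] [Module R A] [Nontrivial A]
    (hA : FinUdim R A) : (leftAss R A).Nonempty := by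
  obtain ⟨U, -, hU⟩ := hA.exists_uniformSub_le (V := ⊤) top_ne_bot
  exact ⟨_, U, hU, rfl⟩

/-- Among the submodules that do not have `X` as an associated left prime there is a
maximal one. -/
theorem exists_maximal_notMem_leftAss (A : Type v) [AddCommGroup A] [Module R A]
    (X : LeftSpec.{u, v} R) :
    ∃ P : Submodule R A, Maximal (fun Q : Submodule R A => X ∉ leftAss R Q) P := by
  refine zorn_le₀ {P : Submodule R A | X ∉ leftAss R P} fun c hc hchain => ?_
  rcases c.eq_empty_or_nonempty with rfl | hne
  · exact ⟨⊥, by simp [leftAss_eq_empty_of_subsingleton], by simp⟩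
  refine ⟨sSup c, ?_, fun _ => le_sSup⟩
  rintro ⟨U, hU, rfl⟩
  have := hU.1
  obtain ⟨a, ha⟩ := exists_ne (0 : U)
  obtain ⟨P, hP, haP⟩ := (Submodule.mem_sSup_of_directed hne hchain.directedOn).mp a.1.2
  let T := R ∙ a
  have hT : Nontrivial T := Submodule.nontrivial_iff_ne_bot.mpr
    (by rwa [Ne, Submodule.span_singleton_eq_bot])
  obtain ⟨h₁, h₂⟩ := UniformMod.of_injective (A := T) (B := U) hU T.subtype T.injective_subtype
  let j : T →ₗ[R] A := (sSup c).subtype ∘ₗ U.subtype ∘ₗ T.subtype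
  have hjP (t : T) : j t ∈ P := by
    obtain ⟨r, hr⟩ := Submodule.mem_span_singleton.mp t.2
    have : j t = r • (a : A) := by
      simp [j, ← hr]
    rw [this]
    exact P.smul_mem r haP
  have hj : Function.Injective j := (sSup c).injective_subtype.comp
    (U.injective_subtype.comp T.injective_subtype)
  refine hc hP ?_
  rw [← h₂]
  exact leftPrime_mem_leftAss h₁ (j.codRestrict P hjP)
    fun s t hst => hj (congrArg P.subtype hst)

theorem leftAss_quotient_subset_of_maximal {A : Type v} [AddCommGroup A] [Module R A]
    {X : LeftSpec.{u, v} R} {P : Submodule R A}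
    (hP : Maximal (fun Q : Submodule R A => X ∉ leftAss R Q) P) :
    leftAss R (A ⧸ P) ⊆ {X} := by
  rintro _ ⟨V, hV, rfl⟩
  have hPV : P ≤ V.comap P.mkQ := by
    intro p hp
    simp [(Submodule.Quotient.mk_eq_zero P).mpr hp]
  have hX : X ∈ leftAss R (V.comap P.mkQ) := by
    by_contra hX
    have hle := hP.2 hX hPV
    refine Submodule.nontrivial_iff_ne_bot.mp hV.1 ?_
    rw [← Submodule.map_comap_eq_of_surjective P.mkQ_surjective V, eq_bot_iff,
      Submodule.map_le_iff_le_comap, Submodule.comap_bot, Submodule.ker_mkQ]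
    exact hle
  obtain ⟨U, hU, rfl⟩ := hX
  have := hU.1
  let p : U →ₗ[R] A := (V.comap P.mkQ).subtype ∘ₗ U.subtype
  have hp : Function.Injective p := (V.comap P.mkQ).injective_subtype.comp U.injective_subtype
  let q : U →ₗ[R] V := (P.mkQ ∘ₗ p).codRestrict V fun u => u.1.2
  by_cases hq : LinearMap.ker q = ⊥
  · exact (UniformMod.of_injective hV q (LinearMap.ker_eq_bot.mp hq)).2.symm
  · have : Nontrivial (LinearMap.ker q) := Submodule.nontrivial_iff_ne_bot.mpr hq
    obtain ⟨h₁, h₂⟩ := UniformMod.of_injective (A := LinearMap.ker q) (B := U) hU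
      (LinearMap.ker q).subtype (LinearMap.ker q).injective_subtype
    refine absurd ?_ hP.1
    rw [← h₂]
    refine leftPrime_mem_leftAss h₁
      ((p ∘ₗ (LinearMap.ker q).subtype).codRestrict P fun k => ?_) fun s t hst =>
        Subtype.ext (hp (congrArg P.subtype hst))
    have hk : q k.1 = 0 := k.2
    exact (Submodule.Quotient.mk_eq_zero P).mp (congrArg Subtype.val hk)

theorem IsPrimaryDecomp.exists_leftAss_subset_range {M : Type v} [AddCommGroup M] [Module R M]
    {N : Submodule R M} {s : ℕ} {Ns : Fin s → Submodule R M} (h : IsPrimaryDecomp R N s Ns) :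
    ∃ X : Fin s → LeftSpec.{u, v} R, leftAss R (M ⧸ N) ⊆ Set.range X := by
  obtain ⟨hN, hNs⟩ := h
  choose X hX using hNs
  refine ⟨X, ?_⟩
  have hle (i) : N ≤ Ns i := hN ▸ iInf_le _ i
  have hker : ⨅ i, LinearMap.ker (Submodule.factor (hle i)) = ⊥ := by
    rw [eq_bot_iff]
    intro x hx
    obtain ⟨m, rfl⟩ := N.mkQ_surjective x
    rw [Submodule.mem_bot, Submodule.mkQ_apply, Submodule.Quotient.mk_eq_zero, hN,
      Submodule.mem_iInf]
    intro i
    have := (Submodule.mem_iInf _).mp hx i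
    simpa using this
  intro x hx
  obtain ⟨i, hi⟩ := Set.mem_iUnion.mp (leftAss_subset_iUnion _ hker hx)
  rw [(hX i).2, Set.mem_singleton_iff] at hi
  exact ⟨i, hi.symm⟩

theorem IsPrimaryDecomp.finite_leftAss {M : Type v} [AddCommGroup M] [Module R M]
    {N : Submodule R M} {s : ℕ} {Ns : Fin s → Submodule R M} (h : IsPrimaryDecomp R N s Ns) :
    (leftAss R (M ⧸ N)).Finite := by
  obtain ⟨X, hX⟩ := h.exists_leftAss_subset_range
  exact (Set.finite_range X).subset hX

theorem IsPrimaryDecomp.ncard_leftAss_le {M : Type v} [AddCommGroup M] [Module R M]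
    {N : Submodule R M} {s : ℕ} {Ns : Fin s → Submodule R M} (h : IsPrimaryDecomp R N s Ns) :
    (leftAss R (M ⧸ N)).ncard ≤ s := by
  obtain ⟨X, hX⟩ := h.exists_leftAss_subset_range
  calc (leftAss R (M ⧸ N)).ncard ≤ (Set.range X).ncard :=
        Set.ncard_le_ncard hX (Set.finite_range X)
    _ ≤ Nat.card (Fin s) := by
        rw [← Set.image_univ, ← Set.ncard_univ]
        exact Set.ncard_image_le
    _ = s := Nat.card_fin s

theorem UniformlyFinite.exists_isPrimaryDecomp_ncard {M : Type v} [AddCommGroup M] [Module R M]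
    (hM : UniformlyFinite R M) (N : Submodule R M) (hfin : (leftAss R (M ⧸ N)).Finite) :
    ∃ Ns : Fin (leftAss R (M ⧸ N)).ncard → Submodule R M, IsPrimaryDecomp R N _ Ns := by
  have := hfin.to_subtype
  let e : Fin (leftAss R (M ⧸ N)).ncard ≃ leftAss R (M ⧸ N) :=
    (Finite.equivFin (leftAss R (M ⧸ N))).symm
  choose P hP using exists_maximal_notMem_leftAss (R := R) (M ⧸ N)
  have hprim (X) (hX : X ∈ leftAss R (M ⧸ N)) : PrimarySub R ((P X).comap N.mkQ) X := by
    refine ⟨hM _, ?_⟩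
    let f : (M ⧸ (P X).comap N.mkQ) →ₗ[R] ((M ⧸ N) ⧸ P X) :=
      Submodule.mapQ _ _ N.mkQ le_rfl
    have hf : Function.Injective f := by
      rw [← LinearMap.ker_eq_bot, Submodule.ker_mapQ, Submodule.mkQ_map_self]
    have hsub := (leftAss_subset_of_injective f hf).trans
      (leftAss_quotient_subset_of_maximal (hP X))
    have : Nontrivial (M ⧸ (P X).comap N.mkQ) := by
      rw [Submodule.Quotient.nontrivial_iff]
      intro htop
      have hPtop : P X = ⊤ := by
        rw [← Submodule.map_comap_eq_of_surjective N.mkQ_surjective (P X), htop,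
          Submodule.map_top, Submodule.range_mkQ]
      refine (hP X).1 ?_
      rw [hPtop]
      exact leftAss_subset_of_injective Submodule.topEquiv.symm.toLinearMap
        Submodule.topEquiv.symm.injective hX
    exact (Set.Nonempty.subset_singleton_iff (hM _).leftAss_nonempty).mp hsub
  refine ⟨fun i => (P (e i)).comap N.mkQ, ?_, fun i => ⟨e i, hprim _ (e i).2⟩⟩
  have hbot : ⨅ i, P (e i) = ⊥ := by
    by_contra hne
    obtain ⟨U, hUle, hU⟩ := (hM N).exists_uniformSub_le hne
    let X : leftAss R (M ⧸ N) := ⟨leftPrime R U, U, hU, rfl⟩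
    have hUX : U ≤ P X := by
      have := hUle.trans (iInf_le _ (e.symm X))
      rwa [Equiv.apply_symm_apply] at this
    exact (hP X).1 (leftPrime_mem_leftAss hU (Submodule.inclusion hUX)
      (Submodule.inclusion_injective hUX))
  rw [← Submodule.comap_iInf, hbot, Submodule.comap_bot, Submodule.ker_mkQ]

end Uniform

/-- Theorem `RlufAss`(4): a primary decomposition
`N = L₁ ∩ ⋯ ∩ L_r` of a proper submodule `N` of a nonzero uniformly finite module `M`
is shortest iff `r = |As_R(M/N)|`. -/
theorem shortest_iff_card_leftAss
    {R : Type u} [Ring R] {M : Type v} [AddCommGroup M] [Module R M]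
    (hM : Nontrivial M) (huf : UniformlyFinite R M)
    (N : Submodule R M) (hN : N ≠ ⊤)
    (r : ℕ) (Ls : Fin r → Submodule R M)
    (hdec : IsPrimaryDecomp R N r Ls) :
    IsShortestPrimaryDecomp R N r Ls ↔ r = (leftAss R (M ⧸ N)).ncard := by
  constructor
  · rintro ⟨-, hshort⟩
    obtain ⟨Ns, hNs⟩ := huf.exists_isPrimaryDecomp_ncard N hdec.finite_leftAss
    exact le_antisymm (hshort _ Ns hNs) hdec.ncard_leftAss_le
  · rintro rfl
    exact ⟨hdec, fun t Ts hTs => hTs.ncard_leftAss_le⟩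
end

section
/- Let M be a nonzero Noetherian R-module and N a submodule with N ≠ M. Then (1) N is a finite intersection of irreducible submodules of M; (2) every irreducible submodule L of M with L ≠ M satisfies u.dim(M/L) = 1, i.e. M/L is a uniform module, so L is a [M/L]-primary submodule of M; consequently N admits a primary decomposition in M. -/
/-!
Definitions following Bavula, "Primary decompositions for left Noetherian rings".
All modules are left modules over an associative ring `R` with 1.
-/

universe u v

section Helpers

variable {R : Type u} [Ring R] {A : Type v} [AddCommGroup A] [Module R A]

lemma essentialSub_top : EssentialSub R (⊤ : Submodule R A) := by
  intro L hL
  simpa using hL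

lemma UniformMod.inf_ne_bot (h : UniformMod R A) {V W : Submodule R A}
    (hV : V ≠ ⊥) (hW : W ≠ ⊥) : V ⊓ W ≠ ⊥ :=
  h.2 V hV W hW

lemma UniformSub.ne_bot {U : Submodule R A} (hU : UniformSub R U) : U ≠ ⊥ :=
  (Submodule.nontrivial_iff_ne_bot).1 hU.1

/-- Nonzero submodules of uniform modules are uniform. -/
lemma UniformMod.uniformSub (h : UniformMod R A) {U : Submodule R A} (hU : U ≠ ⊥) :
    UniformSub R U := by
  refine ⟨(Submodule.nontrivial_iff_ne_bot).2 hU, fun V hV W hW hVW => ?_⟩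
  have map_ne_bot : ∀ {X : Submodule R U}, X ≠ ⊥ → X.map U.subtype ≠ ⊥ := fun hX hX' =>
    hX <| Submodule.map_injective_of_injective U.injective_subtype <|
      hX'.trans (Submodule.map_bot _).symm
  refine h.inf_ne_bot (map_ne_bot hV) (map_ne_bot hW) ?_
  rw [← Submodule.map_inf _ U.injective_subtype, hVW, Submodule.map_bot]

/-- An essential submodule has the same class as the ambient module. -/
lemma EssentialSub.leftPrime_eq {U : Submodule R A} (hU : EssentialSub R U) :
    leftPrime R U = leftPrime R A :=
  Quot.sound ⟨(⊤ : Submodule R U), U, essentialSub_top, hU, ⟨Submodule.topEquiv⟩⟩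

/-- A uniform module has itself as its only associated left prime. -/
lemma UniformMod.leftAss_eq (h : UniformMod R A) : leftAss R A = {leftPrime R A} := by
  ext x
  constructor
  · rintro ⟨U, hU, rfl⟩
    exact (h.2 U hU.ne_bot).leftPrime_eq
  · rintro rfl
    have := h.1
    exact ⟨⊤, h.uniformSub top_ne_bot, essentialSub_top.leftPrime_eq.symm⟩

lemma finUdim_of_isNoetherian [IsNoetherian R A] : FinUdim R A := by
  rintro ⟨f, hf, hind⟩
  have := WellFoundedGT.finite_of_iSupIndep hind hf
  exact not_finite ℕ

lemma InfIrred.irreducibleSub {N : Submodule R A} (h : InfIrred N) : IrreducibleSub R N := by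
  refine ⟨fun hN => h.1 (hN ▸ isMax_top), ?_⟩
  rintro ⟨P, Q, hP, hQ, hN⟩
  rcases h.2 hN.symm with h | h
  · exact hP.ne' h
  · exact hQ.ne' h

lemma IrreducibleSub.uniformMod_quotient {L : Submodule R A} (h : IrreducibleSub R L) :
    UniformMod R (A ⧸ L) := by
  refine ⟨Submodule.Quotient.nontrivial_iff.2 h.1, fun V hV W hW hVW => h.2 ?_⟩
  have lt_comap : ∀ {X : Submodule R (A ⧸ L)}, X ≠ ⊥ → L < X.comap L.mkQ := fun {X} hX => by
    refine lt_of_le_of_ne (L.le_comap_mkQ X) fun hL => hX ?_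
    rw [← Submodule.map_comap_eq_of_surjective L.mkQ_surjective X, ← hL, Submodule.mkQ_map_self]
  refine ⟨_, _, lt_comap hV, lt_comap hW, ?_⟩
  rw [← Submodule.comap_inf, hVW, Submodule.comap_bot, Submodule.ker_mkQ]

lemma IrreducibleSub.primarySub [IsNoetherian R A] {L : Submodule R A}
    (h : IrreducibleSub R L) : PrimarySub R L (leftPrime R (A ⧸ L)) :=
  ⟨finUdim_of_isNoetherian, h.uniformMod_quotient.leftAss_eq⟩

/-- Every submodule of a Noetherian module is a finite intersection of irreducible ones. -/
lemma exists_eq_iInf_irreducibleSub [IsNoetherian R A] (N : Submodule R A) :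
    ∃ (s : ℕ) (Ls : Fin s → Submodule R A), N = ⨅ i, Ls i ∧ ∀ i, IrreducibleSub R (Ls i) := by
  obtain ⟨t, ht, hirr⟩ := exists_infIrred_decomposition N
  refine ⟨t.card, fun i => t.equivFin.symm i, ?_,
    fun i => (hirr (t.equivFin.symm i).2).irreducibleSub⟩
  rw [t.equivFin.symm.iInf_comp (g := fun x : t => (x : Submodule R A)), ← ht,
    Finset.inf_id_eq_sInf, sInf_eq_iInf']
  rfl

end Helpers

/-- Corollary `1RlufAss`: for a nonzero Noetherian module `M` and a
proper submodule `N`: (1) `N` is a finite intersection of irreducible submodules;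
(2) every irreducible submodule `L ⊊ M` has `M/L` uniform, hence `L` is
`[M/L]`-primary; consequently `N` admits a primary decomposition in `M`. -/
theorem noetherian_primaryDecomposition
    {R : Type u} [Ring R] {M : Type v} [AddCommGroup M] [Module R M]
    [IsNoetherian R M] (hM : Nontrivial M)
    (N : Submodule R M) (hN : N ≠ ⊤) :
    (∃ (s : ℕ) (Ls : Fin s → Submodule R M),
        N = ⨅ i, Ls i ∧ ∀ i, IrreducibleSub R (Ls i)) ∧
    (∀ L : Submodule R M, IrreducibleSub R L →
        UniformMod R (M ⧸ L) ∧ PrimarySub R L (leftPrime R (M ⧸ L))) ∧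
    (∃ (s : ℕ) (Ns : Fin s → Submodule R M), IsPrimaryDecomp R N s Ns) := by
  obtain ⟨s, Ls, hLs, hirr⟩ := exists_eq_iInf_irreducibleSub N
  exact ⟨⟨s, Ls, hLs, hirr⟩, fun L hL => ⟨hL.uniformMod_quotient, hL.primarySub⟩,
    ⟨s, Ls, hLs, fun i => ⟨_, (hirr i).primarySub⟩⟩⟩
end
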